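/- (Theorem: GAM ⊆ COM) Assume the GAM axioms hold. Then, taking co to be mo restricted to pairs of same-address writes, both COM axioms hold: rf ∪ co ∪ fr ∪ poloc is acyclic (SC-per-Location), and rfe ∪ co ∪ fr ∪ ppo is acyclic (Causality). -/

import Mathlib

universe u v w

/-- A relation is acyclic when its transitive closure is irreflexive. -/
def Acyclic {E : Type u} (r : E → E → Prop) : Prop :=
  ∀ e, ¬ Relation.TransGen r e e

/-- A GAM execution: events (each exactly one of read/write) with addresses and
threads, program order `po`, reads-from `rf`, preserved program order `ppo`,
and a memory order `mo` satisfying the GAM axioms (Inst-Order and Load-Value). -/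
structure GAM (E : Type u) (A : Type v) (T : Type w) where
  isRead : E → Prop
  isWrite : E → Prop
  read_or_write : ∀ e, isRead e ∨ isWrite e
  not_read_and_write : ∀ e, ¬ (isRead e ∧ isWrite e)
  addr : E → A
  tid : E → T
  po : E → E → Prop
  po_irrefl : ∀ e, ¬ po e e
  po_trans : ∀ {a b c}, po a b → po b c → po a c
  po_same_tid : ∀ {a b}, po a b → tid a = tid b
  po_total : ∀ a b, tid a = tid b → a ≠ b → po a b ∨ po b a
  rf : E → E → Prop
  rf_write : ∀ {w r}, rf w r → isWrite w
  rf_read : ∀ {w r}, rf w r → isRead r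
  rf_addr : ∀ {w r}, rf w r → addr w = addr r
  rf_unique : ∀ r, isRead r → ∃! w, rf w r
  ppo : E → E → Prop
  ppo_sub_po : ∀ {a b}, ppo a b → po a b
  ppo_rw : ∀ {r w}, isRead r → isWrite w → addr r = addr w → po r w → ppo r w
  ppo_ww : ∀ {w₁ w₂}, isWrite w₁ → isWrite w₂ → addr w₁ = addr w₂ → po w₁ w₂ → ppo w₁ w₂
  ppo_rr : ∀ {r₁ r₂}, isRead r₁ → isRead r₂ → addr r₁ = addr r₂ → po r₁ r₂ →
      (∀ w, isWrite w → addr w = addr r₁ → po r₁ w → ¬ po w r₂) → ppo r₁ r₂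
  mo : E → E → Prop
  mo_irrefl : ∀ e, ¬ mo e e
  mo_trans : ∀ {a b c}, mo a b → mo b c → mo a c
  mo_total : ∀ a b, a ≠ b → mo a b ∨ mo b a
  /-- GAM axiom Inst-Order: `ppo ⊆ mo`. -/
  inst_order : ∀ {a b}, ppo a b → mo a b
  /-- GAM axiom Load-Value, membership part: the write read by `r` is in the
  candidate set, i.e. it precedes `r` in `po` or in `mo`. -/
  load_value_mem : ∀ {w r}, rf w r → po w r ∨ mo w r
  /-- GAM axiom Load-Value, maximality part: the write read by `r` is the
  `mo`-greatest element of the candidate set. -/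
  load_value_max : ∀ {w r}, rf w r → ∀ w', isWrite w' → addr w' = addr r →
      (po w' r ∨ mo w' r) → w' ≠ w → mo w' w

namespace GAM

variable {E : Type u} {A : Type v} {T : Type w} (M : GAM E A T)

/-- Reads-from external: reads-from edges between different threads. -/
def rfe (x y : E) : Prop := M.rf x y ∧ M.tid x ≠ M.tid y

/-- Coherence: `mo` restricted to pairs of same-address writes. -/
def co (x y : E) : Prop := M.mo x y ∧ M.isWrite x ∧ M.isWrite y ∧ M.addr x = M.addr y

/-- From-reads: `rf⁻¹ ; co`. -/
def fr (x y : E) : Prop := ∃ w, M.rf w x ∧ M.co w y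

/-- Program order restricted to same-address pairs. -/
def poloc (x y : E) : Prop := M.po x y ∧ M.addr x = M.addr y

/-- `eco = co ∪ fr ∪ (co* ; rf) ∪ (rf⁻¹ ; co* ; rf)`. -/
def eco (x y : E) : Prop :=
  M.co x y ∨ M.fr x y ∨
  (∃ z, Relation.ReflTransGen M.co x z ∧ M.rf z y) ∨
  (∃ z z', M.rf z x ∧ Relation.ReflTransGen M.co z z' ∧ M.rf z' y)

end GAM

/-- A relation contained in a transitive irreflexive relation is acyclic. -/
theorem acyclic_of_subset {E : Type u} {r s : E → E → Prop} (h : ∀ x y, r x y → s x y)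
    (htrans : ∀ x y z, s x y → s y z → s x z) (hirrefl : ∀ x, ¬ s x x) : Acyclic r := by
  have key : ∀ x y, Relation.TransGen r x y → s x y := by
    intro x y hxy
    induction hxy with
    | single hr => exact h _ _ hr
    | tail _ hr ih => exact htrans _ _ _ ih (h _ _ hr)
  exact fun e he => hirrefl e (key e e he)

namespace GAM

variable {E : Type u} {A : Type v} {T : Type w} (M : GAM E A T)

theorem rf_functional {a b r : E} (ha : M.rf a r) (hb : M.rf b r) : a = b :=
  (M.rf_unique r (M.rf_read ha)).unique ha hb

theorem mo_asymm {a b : E} (h : M.mo a b) : ¬ M.mo b a :=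
  fun h' => M.mo_irrefl a (M.mo_trans h h')

theorem not_read_of_write {e : E} (h : M.isWrite e) : ¬ M.isRead e :=
  fun h' => M.not_read_and_write e ⟨h', h⟩

theorem rfe_subset_mo {x y : E} (h : M.rfe x y) : M.mo x y :=
  (M.load_value_mem h.1).resolve_left fun hp => h.2 (M.po_same_tid hp)

theorem fr_subset_mo {x y : E} (h : M.fr x y) : M.mo x y := by
  obtain ⟨w, hrf, hmo, hw, hy, ha⟩ := h
  have hne : x ≠ y := fun hxy => M.not_read_of_write hy (hxy ▸ M.rf_read hrf)
  refine (M.mo_total x y hne).resolve_right fun hyx => ?_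
  have hyw : y ≠ w := fun h => M.mo_irrefl w (h ▸ hmo)
  exact M.mo_asymm hmo
    (M.load_value_max hrf y hy (ha.symm.trans (M.rf_addr hrf)) (Or.inr hyx) hyw)

/-- A read's source is `mo`-before every `po`-later write to the same address. -/
theorem mo_of_rf_of_po_write {a r w : E} (hrf : M.rf a r) (hw : M.isWrite w)
    (ha : M.addr r = M.addr w) (hpo : M.po r w) : M.mo a w := by
  rcases M.load_value_mem hrf with hp | hm
  · exact M.inst_order
      (M.ppo_ww (M.rf_write hrf) hw ((M.rf_addr hrf).trans ha) (M.po_trans hp hpo))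
  · exact M.mo_trans hm (M.inst_order (M.ppo_rw (M.rf_read hrf) hw ha hpo))

/-- A candidate write for a read is the read's source or is `mo`-before it. -/
theorem eq_or_mo_of_candidate {a r w : E} (hrf : M.rf a r) (hw : M.isWrite w)
    (ha : M.addr w = M.addr r) (h : M.po w r ∨ M.mo w r) : w = a ∨ M.mo w a :=
  or_iff_not_imp_left.2 fun hne => M.load_value_max hrf w hw ha h hne

/-- The sources of `po`-ordered same-address reads are weakly ordered by `mo`. -/
theorem eq_or_mo_of_po_read {a b r₁ r₂ : E} (h₁ : M.rf a r₁) (h₂ : M.rf b r₂)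
    (ha : M.addr r₁ = M.addr r₂) (hpo : M.po r₁ r₂) : a = b ∨ M.mo a b := by
  by_cases hw : ∃ w, M.isWrite w ∧ M.addr w = M.addr r₁ ∧ M.po r₁ w ∧ M.po w r₂
  · obtain ⟨w, hw, hwa, hp₁, hp₂⟩ := hw
    have haw := M.mo_of_rf_of_po_write h₁ hw hwa.symm hp₁
    rcases M.eq_or_mo_of_candidate h₂ hw (hwa.trans ha) (Or.inl hp₂) with rfl | hwb
    · exact Or.inr haw
    · exact Or.inr (M.mo_trans haw hwb)
  · refine M.eq_or_mo_of_candidate h₂ (M.rf_write h₁) ((M.rf_addr h₁).trans ha) ?_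
    rcases M.load_value_mem h₁ with hp | hm
    · exact Or.inl (M.po_trans hp hpo)
    · exact Or.inr (M.mo_trans hm (M.inst_order (M.ppo_rr (M.rf_read h₁) (M.rf_read h₂) ha hpo
        fun w h h' h₃ h₄ => hw ⟨w, h, h', h₃, h₄⟩)))

/-- Every event has a source write: itself for a write, the write read from for a read. -/
theorem exists_source : ∃ s : E → E,
    (∀ e, M.isWrite e → s e = e) ∧ ∀ e, M.isRead e → M.rf (s e) e := by
  have h : ∀ e, ∃ a, (M.isWrite e → a = e) ∧ (M.isRead e → M.rf a e) := by
    intro e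
    rcases M.read_or_write e with hr | hw
    · obtain ⟨a, ha, -⟩ := M.rf_unique e hr
      exact ⟨a, fun hw => absurd hr (M.not_read_of_write hw), fun _ => ha⟩
    · exact ⟨e, fun _ => rfl, fun hr => absurd hr (M.not_read_of_write hw)⟩
  choose s hs using h
  exact ⟨s, fun e => (hs e).1, fun e => (hs e).2⟩

theorem acyclic_sc_per_location :
    Acyclic (fun x y : E => M.rf x y ∨ M.co x y ∨ M.fr x y ∨ M.poloc x y) := by
  obtain ⟨s, hsw, hsr⟩ := M.exists_source
  refine acyclic_of_subset (s := fun x y => M.mo (s x) (s y) ∨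
    (s x = s y ∧ M.isRead y ∧ (M.isRead x → M.po x y))) ?_ ?_ ?_
  · rintro x y (h | ⟨h, hx, hy, -⟩ | ⟨a, hrf, h, ha, hy, -⟩ | ⟨hpo, ha⟩)
    · have hx := M.rf_write h
      have hy := M.rf_read h
      exact Or.inr ⟨(hsw x hx).trans (M.rf_functional h (hsr y hy)), hy,
        fun hr => absurd hr (M.not_read_of_write hx)⟩
    · left
      rwa [hsw x hx, hsw y hy]
    · left
      rwa [hsw y hy, M.rf_functional (hsr x (M.rf_read hrf)) hrf]
    · rcases M.read_or_write y with hy | hy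
      · have hle : s x = s y ∨ M.mo (s x) (s y) := by
          rcases M.read_or_write x with hx | hx
          · exact M.eq_or_mo_of_po_read (hsr x hx) (hsr y hy) ha hpo
          · rw [hsw x hx]
            exact M.eq_or_mo_of_candidate (hsr y hy) hx ha (Or.inl hpo)
        exact hle.symm.imp_right fun h => ⟨h, hy, fun _ => hpo⟩
      · left
        rw [hsw y hy]
        rcases M.read_or_write x with hx | hx
        · exact M.mo_of_rf_of_po_write (hsr x hx) hy ha hpo
        · rw [hsw x hx]
          exact M.inst_order (M.ppo_ww hx hy ha hpo)
  · rintro x y z (h | ⟨h, hy, hp⟩) (h' | ⟨h', hz, hp'⟩)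
    · exact Or.inl (M.mo_trans h h')
    · exact Or.inl (h' ▸ h)
    · exact Or.inl (h ▸ h')
    · exact Or.inr ⟨h.trans h', hz, fun hx => M.po_trans (hp hx) (hp' hy)⟩
  · rintro x (h | ⟨-, hx, hp⟩)
    · exact M.mo_irrefl _ h
    · exact M.po_irrefl x (hp hx)

theorem acyclic_causality :
    Acyclic (fun x y : E => M.rfe x y ∨ M.co x y ∨ M.fr x y ∨ M.ppo x y) := by
  refine acyclic_of_subset (s := M.mo) ?_ (fun _ _ _ => M.mo_trans) M.mo_irrefl
  rintro x y (h | h | h | h)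
  · exact M.rfe_subset_mo h
  · exact h.1
  · exact M.fr_subset_mo h
  · exact M.inst_order h

end GAM

/-- Theorem (GAM ⊆ COM): under the GAM axioms, taking `co` to be `mo`
restricted to same-address writes, both COM axioms hold: SC-per-Location
(`rf ∪ co ∪ fr ∪ poloc` is acyclic) and Causality
(`rfe ∪ co ∪ fr ∪ ppo` is acyclic). -/
theorem gam_subset_com {E : Type u} {A : Type v} {T : Type w} (M : GAM E A T) :
    Acyclic (fun x y : E => M.rf x y ∨ M.co x y ∨ M.fr x y ∨ M.poloc x y) ∧
    Acyclic (fun x y : E => M.rfe x y ∨ M.co x y ∨ M.fr x y ∨ M.ppo x y) :=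
  ⟨M.acyclic_sc_per_location, M.acyclic_causality⟩
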